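/- arXiv:cond-mat/0108432 — 2 statements merged into one kernel-verified Lean document; each statement's English description precedes it below -/
import Mathlib

section
/- The operator D_a := H|_{ℋ_a} − ((1−a)·N·j/8)·Id − 𝒥_a* K_a 𝒥_a on the a-magnon sector ℋ_a is diagonal in the Ising basis, with ⟨e_σ, D_a e_τ⟩ = [σ = τ] · e(A_σ), where e(A_σ) ≥ 0 is the number of edges of G with both endpoints in the down-set A_σ. -/
open Matrix BigOperators
open scoped ComplexOrder

/-- Spin-1/2 configurations: `true` means spin down. -/
abbrev Conf (V : Type*) := V → Bool

variable {V : Type*}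

/-- The operator `P_{uv}` interchanging the spin values at sites `u` and `v`. -/
noncomputable def swapOp [Fintype V] [DecidableEq V] (u v : V) :
    Matrix (Conf V) (Conf V) ℂ :=
  Matrix.of fun σ τ => if τ = σ ∘ (Equiv.swap u v) then 1 else 0

lemma swapOp_comm [Fintype V] [DecidableEq V] (u v : V) :
    swapOp (V := V) u v = swapOp v u := by
  unfold swapOp
  rw [Equiv.swap_comm]

/-- The spin-1/2 Heisenberg Hamiltonian `H = Σ_{{u,v} ∈ E(G)} ((1/2)·P_{uv} − (1/4)·Id)`. -/
noncomputable def Ham [Fintype V] [DecidableEq V] (G : SimpleGraph V) [DecidableRel G.Adj] :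
    Matrix (Conf V) (Conf V) ℂ :=
  ∑ e ∈ G.edgeFinset,
    Sym2.lift ⟨fun u v => (1/2 : ℂ) • swapOp u v - (1/4 : ℂ) • 1,
      fun u v => by dsimp only; rw [swapOp_comm]⟩ e

/-- The configuration `σ_n` whose single down spin is at `n`. -/
def singleDown [DecidableEq V] (n : V) : Conf V := fun w => decide (w = n)

/-- The one-magnon block `H₁` of `H`, as a matrix indexed by `V`
(via the identification `e_{σ_n} ↦ e_n`). -/
noncomputable def H1 [Fintype V] [DecidableEq V] (G : SimpleGraph V) [DecidableRel G.Adj] :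
    Matrix V V ℂ :=
  Matrix.of fun m n => Ham G (singleDown m) (singleDown n)

/-- Number of down spins `|A_σ|` of a configuration. -/
def downCard [Fintype V] (σ : Conf V) : ℕ := (Finset.univ.filter fun u => σ u = true).card

/-- `e(A_σ, V∖A_σ)`: the number of edges joining the down-set to its complement. -/
noncomputable def crossCount (G : SimpleGraph V) (σ : Conf V) : ℕ :=
  {e : Sym2 V | e ∈ G.edgeSet ∧ ∃ u v : V, σ u = true ∧ σ v = false ∧ e = s(u, v)}.ncard

/-- `e(A_σ)`: the number of edges with both endpoints in the down-set. -/
noncomputable def inCount (G : SimpleGraph V) (σ : Conf V) : ℕ :=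
  {e : Sym2 V | e ∈ G.edgeSet ∧ ∀ u ∈ e, σ u = true}.ncard

/-- The `a`-fold Kronecker sum `K_a` of a matrix `M`. -/
noncomputable def kron {W : Type*} [Fintype W] [DecidableEq W] (a : ℕ) (M : Matrix W W ℂ) :
    Matrix (Fin a → W) (Fin a → W) ℂ :=
  Matrix.of fun f g =>
    ∑ i, M (f i) (g i) * ∏ j ∈ Finset.univ.erase i, (if f j = g j then (1 : ℂ) else 0)

/-- The isometric embedding `𝒥_a : ℋ_a → ((Fin a → V) → ℂ)`,
`𝒥_a e_σ = (a!)^{-1/2} Σ_f e_f`, `f` ranging over bijections `Fin a → A_σ`. -/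
noncomputable def Ja [Fintype V] [DecidableEq V] (a : ℕ) :
    Matrix (Fin a → V) (Conf V) ℂ :=
  Matrix.of fun f σ =>
    if Function.Injective f ∧ (∀ u, σ u = true ↔ ∃ i, f i = u)
    then (Real.sqrt (Nat.factorial a) : ℂ)⁻¹ else 0

/-- Summing a function of edges over ordered pairs of adjacent vertices counts each edge twice. -/
theorem sum_sum_adj_eq_two_nsmul {M : Type*} [AddCommMonoid M] [Fintype V] [DecidableEq V]
    (G : SimpleGraph V) [DecidableRel G.Adj] (F : Sym2 V → M) :
    ∑ u, ∑ v, (if G.Adj u v then F s(u, v) else 0) = 2 • ∑ e ∈ G.edgeFinset, F e := by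
  have hdart : ∑ u, ∑ v, (if G.Adj u v then F s(u, v) else 0) = ∑ d : G.Dart, F d.edge := by
    rw [← Finset.sum_product', ← Finset.sum_filter]
    refine Finset.sum_bij' (fun p h => ⟨p, (Finset.mem_filter.1 h).2⟩)
      (fun d _ => d.toProd) ?_ ?_ ?_ ?_ ?_ <;> simp [SimpleGraph.Dart.edge]
  rw [hdart, ← Finset.sum_fiberwise_of_maps_to (s := Finset.univ) (t := G.edgeFinset)
    (g := fun d : G.Dart => d.edge) (fun d _ => by simp), Finset.smul_sum]
  refine Finset.sum_congr rfl fun e he => ?_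
  rw [← G.dart_edge_fiber_card e (by simpa using he), ← Finset.sum_const]
  refine Finset.sum_congr rfl fun d hd => ?_
  rw [(Finset.mem_filter.1 hd).2]

/-- The number of ways of moving one down spin of `σ` along an edge to obtain `τ`. -/
noncomputable def hopCount [Fintype V] [DecidableEq V] (G : SimpleGraph V) [DecidableRel G.Adj]
    (σ τ : Conf V) : ℂ :=
  ∑ u, ∑ v, if G.Adj u v ∧ σ u = true ∧ σ v = false ∧ τ = σ ∘ Equiv.swap u v then 1 else 0

theorem two_mul_ham_apply [Fintype V] [DecidableEq V] (G : SimpleGraph V) [DecidableRel G.Adj]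
    (σ τ : Conf V) :
    2 * Ham G σ τ = ∑ u, ∑ v, if G.Adj u v then
      ((1/2 : ℂ) * (if τ = σ ∘ Equiv.swap u v then 1 else 0) -
        (1/4 : ℂ) * (if σ = τ then 1 else 0)) else 0 := by
  let F : Sym2 V → Matrix (Conf V) (Conf V) ℂ :=
    Sym2.lift ⟨fun u v => (1/2 : ℂ) • swapOp u v - (1/4 : ℂ) • 1,
      fun u v => by dsimp only; rw [swapOp_comm]⟩
  have h := sum_sum_adj_eq_two_nsmul G (fun e => F e σ τ)
  rw [Ham, Matrix.sum_apply]
  rw [nsmul_eq_mul] at h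
  refine Eq.trans (by simp [F]) (h.symm.trans ?_)
  refine Finset.sum_congr rfl fun u _ => Finset.sum_congr rfl fun v _ => ?_
  simp [F, swapOp, Matrix.one_apply]

theorem two_mul_inCount [Fintype V] [DecidableEq V] (G : SimpleGraph V) [DecidableRel G.Adj]
    (σ : Conf V) :
    2 * (inCount G σ : ℂ) =
      ∑ u, ∑ v, if G.Adj u v then (if σ u = true ∧ σ v = true then 1 else 0) else 0 := by
  have h := sum_sum_adj_eq_two_nsmul G
    (fun e => if ∀ u ∈ e, σ u = true then (1 : ℂ) else 0)
  simp only [Sym2.mem_iff, forall_eq_or_imp, forall_eq] at h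
  rw [h, nsmul_eq_mul, ← Finset.sum_filter, Finset.sum_const, nsmul_one, inCount,
    ← Set.ncard_coe_finset]
  simp

theorem sum_adj_const [Fintype V] [DecidableEq V] {G : SimpleGraph V} [DecidableRel G.Adj] {j : ℕ}
    (hreg : G.IsRegularOfDegree j) (u : V) (c : ℂ) :
    ∑ v, (if G.Adj u v then c else 0) = j * c := by
  rw [← Finset.sum_filter, Finset.sum_const, nsmul_eq_mul, ← hreg u,
    ← SimpleGraph.card_neighborFinset_eq_degree, SimpleGraph.neighborFinset_eq_filter]

theorem ham_apply [Fintype V] [DecidableEq V] {G : SimpleGraph V} [DecidableRel G.Adj] {j : ℕ}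
    (hreg : G.IsRegularOfDegree j) (σ τ : Conf V) :
    Ham G σ τ = ((Fintype.card V : ℂ) * j / 8 - downCard σ * j / 2 + inCount G σ) *
      (if σ = τ then 1 else 0) + hopCount G σ τ / 2 := by
  set δ : ℂ := if σ = τ then 1 else 0 with hδ
  have htot : ∑ u, ∑ v, (if G.Adj u v then (1 : ℂ) else 0) = Fintype.card V * j := by
    simp [sum_adj_const hreg]
  have hdown : ∑ u, ∑ v, (if G.Adj u v then (if σ u = true then (1 : ℂ) else 0) else 0) =
      downCard σ * j := by
    simp_rw [sum_adj_const hreg]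
    simp [downCard, Finset.sum_ite, mul_comm]
  have hdown' : ∑ u, ∑ v, (if G.Adj u v then (if σ v = true then (1 : ℂ) else 0) else 0) =
      downCard σ * j := by
    rw [Finset.sum_comm, ← hdown]
    simp_rw [G.adj_comm]
  have hhop : ∑ u, ∑ v, (if G.Adj u v ∧ σ v = true ∧ σ u = false ∧ τ = σ ∘ Equiv.swap u v
      then (1 : ℂ) else 0) = hopCount G σ τ := by
    rw [Finset.sum_comm, hopCount]
    refine Finset.sum_congr rfl fun u _ => Finset.sum_congr rfl fun v _ => ?_
    simp only [G.adj_comm v u, Equiv.swap_comm v u]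
  have hsplit : ∀ u v, (if G.Adj u v then
      ((1/2 : ℂ) * (if τ = σ ∘ Equiv.swap u v then 1 else 0) - (1/4 : ℂ) * δ) else 0) =
      (δ / 4) * (if G.Adj u v then 1 else 0)
      - (δ / 2) * (if G.Adj u v then (if σ u = true then 1 else 0) else 0)
      - (δ / 2) * (if G.Adj u v then (if σ v = true then 1 else 0) else 0)
      + δ * (if G.Adj u v then (if σ u = true ∧ σ v = true then 1 else 0) else 0)
      + (1 / 2) * (if G.Adj u v ∧ σ u = true ∧ σ v = false ∧ τ = σ ∘ Equiv.swap u v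
          then 1 else 0)
      + (1 / 2) * (if G.Adj u v ∧ σ v = true ∧ σ u = false ∧ τ = σ ∘ Equiv.swap u v
          then 1 else 0) := by
    intro u v
    have hcomp : σ u = σ v → σ ∘ Equiv.swap u v = σ := by
      intro h
      ext w
      by_cases hu : w = u
      · simp [hu, h]
      · by_cases hv : w = v
        · simp [hv, h]
        · simp [Equiv.swap_apply_of_ne_of_ne hu hv]
    by_cases hadj : G.Adj u v
    · cases hu : σ u <;> cases hv : σ v
      · simp [hadj, hcomp (hu.trans hv.symm), hδ, eq_comm]
        split_ifs <;> norm_num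
      · simp [hadj]
        ring
      · simp [hadj]
        ring
      · simp [hadj, hcomp (hu.trans hv.symm), hδ, eq_comm]
        split_ifs <;> norm_num
    · simp [hadj]
  have h := two_mul_ham_apply G σ τ
  simp only [← hδ, hsplit, Finset.sum_add_distrib, Finset.sum_sub_distrib, ← Finset.mul_sum,
    htot, hdown, hdown', ← two_mul_inCount, hhop] at h
  rw [← hopCount] at h
  linear_combination h / 2

theorem H1_apply [Fintype V] [DecidableEq V] {G : SimpleGraph V} [DecidableRel G.Adj] {j : ℕ}
    (hreg : G.IsRegularOfDegree j) (m n : V) :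
    H1 G m n = ((Fintype.card V : ℂ) * j / 8 - j / 2) * (if m = n then 1 else 0) +
      (if G.Adj m n then 1 else 0) / 2 := by
  have hinj : ∀ {m n : V}, singleDown m = singleDown n ↔ m = n := by
    intro m n
    refine ⟨fun h => ?_, fun h => h ▸ rfl⟩
    simpa [singleDown] using congrFun h m
  have hswap : ∀ v, singleDown m ∘ Equiv.swap m v = singleDown v := by
    intro v
    ext w
    simp [singleDown, Equiv.swap_apply_eq_iff]
  have hcard : downCard (singleDown m) = 1 := by
    simp [downCard, singleDown, Finset.filter_eq']
  have hin : inCount G (singleDown m) = 0 := by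
    rw [inCount, Set.ncard_eq_zero]
    refine Set.eq_empty_of_forall_notMem fun e => ?_
    induction e with
    | h x y =>
      rintro ⟨hadj, h⟩
      simp only [Sym2.mem_iff, forall_eq_or_imp, forall_eq, singleDown, decide_eq_true_eq] at h
      exact G.ne_of_adj hadj (h.1.trans h.2.symm)
  have hhop : hopCount G (singleDown m) (singleDown n) = if G.Adj m n then 1 else 0 := by
    rw [hopCount, Finset.sum_eq_single m, Finset.sum_eq_single n]
    · by_cases hadj : G.Adj m n
      · simp [hadj, hswap, singleDown, hadj.ne']
      · simp [hadj]
    · intro v _ hv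
      simp [hswap, hinj, hv.symm]
    · simp
    · intro u _ hu
      simp [singleDown, hu]
    · simp
  rw [H1, Matrix.of_apply, ham_apply hreg, hcard, hin, hhop]
  simp only [hinj]
  push_cast
  ring

/-- `f` is a bijection from `Fin a` onto the down-set of `σ`. -/
abbrev Enumerates {a : ℕ} (f : Fin a → V) (σ : Conf V) : Prop :=
  Function.Injective f ∧ ∀ u, σ u = true ↔ ∃ i, f i = u

theorem Enumerates.iff_eq {a : ℕ} {f : Fin a → V} {σ τ : Conf V} (hf : Enumerates f σ) :
    Enumerates f τ ↔ σ = τ := by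
  refine ⟨fun h => ?_, fun h => h ▸ hf⟩
  ext u
  rw [Bool.eq_iff_iff, hf.2, h.2]

theorem Enumerates.update_iff [DecidableEq V] {a : ℕ} {f : Fin a → V} {σ τ : Conf V}
    (hf : Enumerates f σ) (i : Fin a) {w : V} (hw : w ≠ f i) :
    Enumerates (Function.update f i w) τ ↔ σ w = false ∧ τ = σ ∘ Equiv.swap (f i) w := by
  by_cases hσ : σ w = true
  · obtain ⟨k, rfl⟩ := (hf.2 w).1 hσ
    have hk : k ≠ i := fun h => hw (h ▸ rfl)
    simp only [hσ, Bool.true_eq_false, false_and, iff_false]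
    rintro ⟨hinj, -⟩
    exact hk (hinj (by simp [hk]))
  · have hupd : Function.update f i w = Equiv.swap (f i) w ∘ f := by
      ext k
      by_cases hk : k = i
      · simp [hk]
      · rw [Function.update_of_ne hk, Function.comp_apply, Equiv.swap_apply_of_ne_of_ne]
        · exact fun h => hk (hf.1 h)
        · exact fun h => hσ ((hf.2 w).2 ⟨k, h⟩)
    have henum : Enumerates (Function.update f i w) (σ ∘ Equiv.swap (f i) w) := by
      rw [hupd]
      refine ⟨(Equiv.swap (f i) w).injective.comp hf.1, fun u => ?_⟩
      rw [Function.comp_apply, hf.2]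
      simp [Equiv.swap_apply_eq_iff]
    rw [henum.iff_eq]
    simp [hσ, eq_comm]

theorem Enumerates.sum_comp [Fintype V] {M : Type*} [AddCommMonoid M] {a : ℕ}
    {f : Fin a → V} {σ : Conf V} (hf : Enumerates f σ) (Φ : V → M) :
    ∑ i, Φ (f i) = ∑ u, if σ u = true then Φ u else 0 := by
  classical
  rw [← Finset.sum_filter, ← Finset.sum_image (f := Φ) (g := f) hf.1.injOn]
  congr 1
  ext u
  simp [hf.2]

theorem card_enumerates [Fintype V] [DecidableEq V] {a : ℕ} {σ : Conf V} (hσ : downCard σ = a) :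
    (Finset.univ.filter fun f : Fin a → V => Enumerates f σ).card = a.factorial := by
  have hcard : Fintype.card {u // σ u = true} = a := by rw [Fintype.card_subtype]; exact hσ
  let e : {f : Fin a → V // Enumerates f σ} ≃ (Fin a ≃ {u // σ u = true}) :=
    { toFun := fun f => Equiv.ofBijective (fun i => ⟨f.1 i, (f.2.2 _).2 ⟨i, rfl⟩⟩)
        ⟨fun i k h => f.2.1 (congrArg Subtype.val h), fun u => by
          obtain ⟨i, hi⟩ := (f.2.2 u).1 u.2
          exact ⟨i, Subtype.ext hi⟩⟩
      invFun := fun e => ⟨fun i => e i, Subtype.val_injective.comp e.injective, fun u =>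
        ⟨fun h => ⟨e.symm ⟨u, h⟩, by simp⟩, fun ⟨i, hi⟩ => hi ▸ (e i).2⟩⟩
      left_inv := fun f => rfl
      right_inv := fun e => by ext; rfl }
  rw [← Fintype.card_subtype, Fintype.card_congr e,
    Fintype.card_equiv (Fintype.equivOfCardEq (by simp [hcard])), Fintype.card_fin]

theorem sum_kron_mul {W : Type*} [Fintype W] [DecidableEq W] {a : ℕ} (M : Matrix W W ℂ)
    (f : Fin a → W) (F : (Fin a → W) → ℂ) :
    ∑ g, kron a M f g * F g = ∑ i, ∑ w, M (f i) w * F (Function.update f i w) := by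
  simp only [kron, Matrix.of_apply, Finset.sum_mul]
  rw [Finset.sum_comm]
  refine Finset.sum_congr rfl fun i _ => ?_
  symm
  refine Finset.sum_of_injOn (Function.update f i) (Function.update_injective f i).injOn
    (by simp) (fun g _ hg => ?_) fun w _ => ?_
  · obtain ⟨k, hk, hne⟩ : ∃ k ∈ Finset.univ.erase i, f k ≠ g k := by
      by_contra! h
      refine hg ⟨g i, by simp, ?_⟩
      ext k
      by_cases hk : k = i
      · simp [hk]
      · simp [hk, h k (by simp [hk])]
    rw [Finset.prod_eq_zero hk (if_neg hne), mul_zero, zero_mul]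
  · rw [Finset.prod_eq_one fun k hk => by simp [Finset.ne_of_mem_erase hk],
      Function.update_self, mul_one]

theorem sum_kron_mul_enumerates [Fintype V] [DecidableEq V] {G : SimpleGraph V}
    [DecidableRel G.Adj] {j : ℕ} (hreg : G.IsRegularOfDegree j) {a : ℕ} {f : Fin a → V}
    {σ : Conf V} (hf : Enumerates f σ) (τ : Conf V) :
    ∑ g, kron a (H1 G) f g * (if Enumerates g τ then 1 else 0) =
      a * ((Fintype.card V : ℂ) * j / 8 - j / 2) * (if σ = τ then 1 else 0) +
        hopCount G σ τ / 2 := by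
  rw [sum_kron_mul]
  have hterm : ∀ i w, H1 G (f i) w * (if Enumerates (Function.update f i w) τ then 1 else 0) =
      (if f i = w then ((Fintype.card V : ℂ) * j / 8 - j / 2) * (if σ = τ then 1 else 0) else 0) +
      (if G.Adj (f i) w ∧ σ w = false ∧ τ = σ ∘ Equiv.swap (f i) w then 1 else 0) / 2 := by
    intro i w
    rw [H1_apply hreg]
    by_cases hw : f i = w
    · subst hw
      simp [hf.iff_eq]
    · by_cases hadj : G.Adj (f i) w
      · simp [hw, hadj, hf.update_iff i (Ne.symm hw), ite_div]
      · simp [hw, hadj]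
  simp_rw [hterm, Finset.sum_add_distrib, Finset.sum_ite_eq, Finset.mem_univ, if_true,
    ← Finset.sum_div]
  rw [hf.sum_comp (fun u => ∑ w, if G.Adj u w ∧ σ w = false ∧ τ = σ ∘ Equiv.swap u w
    then (1 : ℂ) else 0), hopCount]
  congr 1
  · simp only [Finset.sum_const, Finset.card_univ, Fintype.card_fin, nsmul_eq_mul, mul_assoc]
  · congr 1
    refine Finset.sum_congr rfl fun u _ => ?_
    split_ifs with hu <;> simp [hu]

theorem Ja_conj_kron_apply [Fintype V] [DecidableEq V] {G : SimpleGraph V}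
    [DecidableRel G.Adj] {j : ℕ} (hreg : G.IsRegularOfDegree j) {a : ℕ} {σ : Conf V}
    (hσ : downCard σ = a) (τ : Conf V) :
    ((Ja (V := V) a)ᴴ * kron a (H1 G) * Ja a : Matrix (Conf V) (Conf V) ℂ) σ τ =
      a * ((Fintype.card V : ℂ) * j / 8 - j / 2) * (if σ = τ then 1 else 0) +
        hopCount G σ τ / 2 := by
  set c : ℂ := (Real.sqrt (Nat.factorial a) : ℂ)⁻¹ with hc
  have hcc : c * c * a.factorial = 1 := by
    have hpos : (0 : ℝ) < a.factorial := by exact_mod_cast a.factorial_pos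
    have hsq : (Real.sqrt a.factorial : ℂ) * Real.sqrt a.factorial = a.factorial := by
      rw [← Complex.ofReal_mul, Real.mul_self_sqrt hpos.le, Complex.ofReal_natCast]
    rw [hc, ← mul_inv, hsq, inv_mul_cancel₀]
    exact_mod_cast a.factorial_ne_zero
  have hJ : ∀ f ρ, Ja (V := V) a f ρ = c * (if Enumerates f ρ then 1 else 0) := by
    intro f ρ
    simp [Ja, hc]
  have hJstar : ∀ f ρ, star (Ja (V := V) a f ρ) = c * (if Enumerates f ρ then 1 else 0) := by
    intro f ρ
    rw [hJ, hc]
    split_ifs <;> simp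
  have hprod : ((Ja (V := V) a)ᴴ * kron a (H1 G) * Ja a : Matrix (Conf V) (Conf V) ℂ) σ τ =
      ∑ g, (∑ f, star (Ja a f σ) * kron a (H1 G) f g) * Ja a g τ := rfl
  have hrow : ∀ f, ∑ g, star (Ja a f σ) * kron a (H1 G) f g * Ja a g τ =
      if Enumerates f σ then c * c * (a * ((Fintype.card V : ℂ) * j / 8 - j / 2) *
        (if σ = τ then 1 else 0) + hopCount G σ τ / 2) else 0 := by
    intro f
    rw [hJstar]
    by_cases hf : Enumerates f σ
    · rw [if_pos hf, if_pos hf, ← sum_kron_mul_enumerates hreg hf τ, Finset.mul_sum]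
      refine Finset.sum_congr rfl fun g _ => ?_
      rw [hJ]
      ring
    · simp [hf]
  simp only [hprod, Finset.sum_mul]
  rw [Finset.sum_comm]
  rw [Finset.sum_congr rfl fun f _ => hrow f, ← Finset.sum_filter, Finset.sum_const,
    card_enumerates hσ, nsmul_eq_mul]
  linear_combination (a * ((Fintype.card V : ℂ) * j / 8 - j / 2) *
    (if σ = τ then 1 else 0) + hopCount G σ τ / 2) * hcc

/-- The operator `D_a = H|_{ℋ_a} − ((1−a)·N·j/8)·Id − 𝒥_a* K_a 𝒥_a` is diagonal in the Ising
basis, with `⟨e_σ, D_a e_τ⟩ = [σ = τ]·e(A_σ)`; in particular its diagonal entries `e(A_σ) ≥ 0`. -/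
theorem defect_diagonal [Fintype V] [DecidableEq V]
    (G : SimpleGraph V) [DecidableRel G.Adj] (N j : ℕ)
    (hN : Fintype.card V = N) (hreg : G.IsRegularOfDegree j)
    (a : ℕ) (ha : 1 ≤ a) (σ τ : Conf V)
    (hσa : downCard σ = a) (hτa : downCard τ = a) :
    Ham G σ τ - ((1 - (a : ℂ)) * (N : ℂ) * (j : ℂ) / 8) * (if σ = τ then 1 else 0)
        - (((Ja (V := V) a)ᴴ * kron a (H1 G) * Ja a : Matrix (Conf V) (Conf V) ℂ)) σ τ
      = if σ = τ then (inCount G σ : ℂ) else 0 := by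
  rw [Ja_conj_kron_apply hreg hσa, ham_apply hreg, hσa, hN]
  split_ifs <;> ring
end

section
/- (Proposition 3, bounding line) Let E₁ be the smallest eigenvalue of H restricted to the one-magnon sector ℋ_1, and let E_a be the smallest eigenvalue of H restricted to the a-magnon sector ℋ_a (1 ≤ a ≤ N). Then E_a ≥ (1−a)·N·j/8 + a·E₁; equivalently, for every nonzero ψ ∈ ℋ_a, ⟨ψ, H ψ⟩ ≥ ((1−a)·N·j/8 + a·E₁)·‖ψ‖². Thus all points (a, E_a) lie on or above the straight line ℓ(a) = (1−a)·N·j/8 + a·E₁ through the points for a = 0 and a = 1. -/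
open Matrix BigOperators
open scoped ComplexOrder

variable {V : Type*}

section ExchangeForm

variable {α : Type*} [Fintype α]

/-- The Dirichlet form of a permutation `f`, i.e. `Σ ‖x n − x (f n)‖²`. -/
noncomputable def permForm (f : α → α) (x : α → ℂ) : ℝ := ∑ n, ‖x n - x (f n)‖ ^ 2

lemma star_dotProduct_self_eq_sum_norm_sq (x : α → ℂ) :
    star x ⬝ᵥ x = ((∑ n, ‖x n‖ ^ 2 : ℝ) : ℂ) := by
  simp [dotProduct, Complex.conj_mul']

lemma star_dotProduct_exchange (f : α → α) (hf : Function.Involutive f) (x : α → ℂ) :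
    (star x ⬝ᵥ fun n => (1 / 2 : ℂ) * x (f n) - (1 / 4 : ℂ) * x n) =
      ((1 / 4 * ∑ n, ‖x n‖ ^ 2 - 1 / 4 * permForm f x : ℝ) : ℂ) := by
  have reindex (g : α → ℂ) : ∑ n, g (f n) = ∑ n, g n := Equiv.sum_comp hf.toPerm g
  have hcross : ∑ n, star (x (f n)) * x n = ∑ n, star (x n) * x (f n) := by
    rw [← reindex fun n => star (x n) * x (f n)]
    simp only [hf _]
  have hsq : ∑ n, star (x (f n)) * x (f n) = ∑ n, star (x n) * x n :=
    reindex fun n => star (x n) * x n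
  have hexp : ((permForm f x : ℝ) : ℂ) =
      2 * ∑ n, star (x n) * x n - 2 * ∑ n, star (x n) * x (f n) := by
    have : ((permForm f x : ℝ) : ℂ) =
        ∑ n, (star (x n) * x n + star (x (f n)) * x (f n)
          - star (x n) * x (f n) - star (x (f n)) * x n) := by
      simp only [permForm, Complex.ofReal_sum, Complex.ofReal_pow, ← Complex.conj_mul']
      refine Finset.sum_congr rfl fun n _ => ?_
      simp only [map_sub, Complex.star_def]
      ring
    rw [this]
    simp only [Finset.sum_sub_distrib, Finset.sum_add_distrib, hcross, hsq]
    ring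
  have hnorm := star_dotProduct_self_eq_sum_norm_sq x
  simp only [dotProduct, Pi.star_apply] at hnorm ⊢
  rw [Complex.ofReal_sub, Complex.ofReal_mul, Complex.ofReal_mul, hexp, ← hnorm]
  simp only [mul_sub, Finset.sum_sub_distrib, mul_left_comm (star _), ← Finset.mul_sum]
  push_cast
  ring

end ExchangeForm

section Sites

variable [DecidableEq V]

/-- The transposition of the two endpoints of an edge. -/
def edgeSwap (e : Sym2 V) : Equiv.Perm V :=
  Sym2.lift ⟨fun u v => Equiv.swap u v, fun u v => Equiv.swap_comm u v⟩ e

lemma edgeSwap_involutive (e : Sym2 V) : Function.Involutive (edgeSwap e) := by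
  induction e with
  | _ u v => exact fun n => Equiv.swap_apply_self u v n

lemma comp_edgeSwap_involutive (e : Sym2 V) :
    Function.Involutive fun σ : Conf V => σ ∘ edgeSwap e := by
  intro σ
  funext n
  simp [edgeSwap_involutive e n]

lemma singleDown_comp_edgeSwap (m : V) (e : Sym2 V) :
    singleDown m ∘ edgeSwap e = singleDown (edgeSwap e m) := by
  funext w
  have : edgeSwap e w = m ↔ w = edgeSwap e m :=
    ⟨fun h => by rw [← h, edgeSwap_involutive e], fun h => by rw [h, edgeSwap_involutive e]⟩
  simp [singleDown, this]

lemma singleDown_injective : Function.Injective (singleDown (V := V)) := by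
  intro m n h
  simpa [singleDown] using congrFun h m

/-- Adding a down spin at `n` to the configuration `τ`, evaluated in `ψ`; it vanishes when
`τ` is already down at `n`. -/
def addDown (ψ : Conf V → ℂ) (τ : Conf V) (n : V) : ℂ :=
  if τ n = true then 0 else ψ (Function.update τ n true)

lemma addDown_update_swap (ψ : Conf V → ℂ) (σ : Conf V) {u v : V}
    (hu : σ u = true) (hv : σ v = false) :
    addDown ψ (Function.update σ u false) v = ψ (σ ∘ Equiv.swap u v) := by
  have huv : v ≠ u := by
    rintro rfl
    simp [hu] at hv
  rw [addDown, Function.update_of_ne huv, hv, if_neg (by simp)]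
  congr 1
  funext w
  rcases eq_or_ne w v with rfl | hwv
  · simp [hu]
  · rcases eq_or_ne w u with rfl | hwu
    · simp [hv, hwv]
    · simp [hwv, hwu, Equiv.swap_apply_of_ne_of_ne hwu hwv]

variable [Fintype V] (G : SimpleGraph V) [DecidableRel G.Adj]

lemma Ham_apply (σ τ : Conf V) :
    Ham G σ τ = ∑ e ∈ G.edgeFinset,
      ((1 / 2 : ℂ) * (if τ = σ ∘ edgeSwap e then 1 else 0)
        - (1 / 4 : ℂ) * (if τ = σ then 1 else 0)) := by
  rw [Ham, Matrix.sum_apply]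
  refine Finset.sum_congr rfl fun e _ => ?_
  induction e with
  | _ u v =>
    simp only [swapOp, edgeSwap, Sym2.lift_mk, Matrix.sub_apply, Matrix.smul_apply,
      Matrix.of_apply, Matrix.one_apply, smul_eq_mul, eq_comm (a := σ) (b := τ)]
    congr

lemma Ham_mulVec (ψ : Conf V → ℂ) :
    Ham G *ᵥ ψ = ∑ e ∈ G.edgeFinset, fun σ =>
      (1 / 2 : ℂ) * ψ (σ ∘ edgeSwap e) - (1 / 4 : ℂ) * ψ σ := by
  funext σ
  simp only [mulVec, dotProduct, Ham_apply, Finset.sum_apply, Finset.sum_mul]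
  rw [Finset.sum_comm]
  refine Finset.sum_congr rfl fun e _ => ?_
  simp [sub_mul, Finset.sum_sub_distrib]

lemma H1_apply_s9 (m n : V) :
    H1 G m n = ∑ e ∈ G.edgeFinset,
      ((1 / 2 : ℂ) * (if n = edgeSwap e m then 1 else 0)
        - (1 / 4 : ℂ) * (if n = m then 1 else 0)) := by
  simp only [H1, Matrix.of_apply, Ham_apply, singleDown_comp_edgeSwap,
    singleDown_injective.eq_iff]

lemma H1_mulVec (x : V → ℂ) :
    H1 G *ᵥ x = ∑ e ∈ G.edgeFinset, fun n =>
      (1 / 2 : ℂ) * x (edgeSwap e n) - (1 / 4 : ℂ) * x n := by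
  funext n
  simp only [mulVec, dotProduct, H1_apply_s9, Finset.sum_apply, Finset.sum_mul]
  rw [Finset.sum_comm]
  refine Finset.sum_congr rfl fun e _ => ?_
  simp [sub_mul, Finset.sum_sub_distrib]

lemma H1_isHermitian : (H1 G).IsHermitian := by
  refine Matrix.IsHermitian.ext fun m n => ?_
  have h (e : Sym2 V) : m = edgeSwap e n ↔ n = edgeSwap e m :=
    ⟨fun h => by rw [h, edgeSwap_involutive e], fun h => by rw [h, edgeSwap_involutive e]⟩
  simp only [H1_apply_s9, star_sum, h, eq_comm (a := m) (b := n)]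
  refine Finset.sum_congr rfl fun e _ => ?_
  split_ifs <;> simp

/-- The energy of `ψ` is that of the polarized state minus a Dirichlet form. -/
lemma star_dotProduct_Ham (ψ : Conf V → ℂ) :
    star ψ ⬝ᵥ (Ham G *ᵥ ψ) =
      ((G.edgeFinset.card / 4 * ∑ σ, ‖ψ σ‖ ^ 2
        - 1 / 4 * ∑ e ∈ G.edgeFinset, permForm (· ∘ edgeSwap e) ψ : ℝ) : ℂ) := by
  rw [Ham_mulVec, dotProduct_sum,
    Finset.sum_congr rfl fun e _ => star_dotProduct_exchange _ (comp_edgeSwap_involutive e) ψ,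
    ← Complex.ofReal_sum, Finset.sum_sub_distrib, Finset.sum_const, nsmul_eq_mul,
    ← Finset.mul_sum]
  congr 2
  ring

lemma star_dotProduct_H1 (x : V → ℂ) :
    star x ⬝ᵥ (H1 G *ᵥ x) =
      ((G.edgeFinset.card / 4 * ∑ n, ‖x n‖ ^ 2
        - 1 / 4 * ∑ e ∈ G.edgeFinset, permForm (edgeSwap e) x : ℝ) : ℂ) := by
  rw [H1_mulVec, dotProduct_sum,
    Finset.sum_congr rfl fun e _ => star_dotProduct_exchange _ (edgeSwap_involutive e) x,
    ← Complex.ofReal_sum, Finset.sum_sub_distrib, Finset.sum_const, nsmul_eq_mul,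
    ← Finset.mul_sum]
  congr 2
  ring

lemma sum_removeDown (g : Conf V → V → ℝ) :
    ∑ σ : Conf V, ∑ n, (if σ n = true then g (Function.update σ n false) n else 0) =
      ∑ τ : Conf V, ∑ n, (if τ n = true then 0 else g τ n) := by
  rw [Finset.sum_comm, Finset.sum_comm (f := fun (τ : Conf V) n => if τ n = true then 0 else g τ n)]
  refine Finset.sum_congr rfl fun n _ => ?_
  have hinv : Function.Involutive fun σ : Conf V => Function.update σ n (!σ n) := by
    intro σ
    simp
  refine Fintype.sum_equiv hinv.toPerm _ _ fun σ => ?_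
  cases h : σ n <;> simp [h]

lemma sum_norm_sq_addDown (ψ : Conf V → ℂ) (a : ℕ) (hψ : ∀ σ, ψ σ ≠ 0 → downCard σ = a) :
    ∑ τ, ∑ n, ‖addDown ψ τ n‖ ^ 2 = a * ∑ σ, ‖ψ σ‖ ^ 2 := by
  have h := sum_removeDown fun τ n => ‖ψ (Function.update τ n true)‖ ^ 2
  calc ∑ τ, ∑ n, ‖addDown ψ τ n‖ ^ 2
      = ∑ τ : Conf V, ∑ n,
          (if τ n = true then 0 else ‖ψ (Function.update τ n true)‖ ^ 2) := by
        refine Finset.sum_congr rfl fun τ _ => Finset.sum_congr rfl fun n _ => ?_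
        unfold addDown
        split_ifs <;> simp
    _ = ∑ σ : Conf V, ∑ n, (if σ n = true then ‖ψ σ‖ ^ 2 else 0) := by
        rw [← h]
        refine Finset.sum_congr rfl fun σ _ => Finset.sum_congr rfl fun n _ => ?_
        split_ifs with hn
        · rw [Function.update_idem, ← hn, Function.update_eq_self]
        · rfl
    _ = a * ∑ σ, ‖ψ σ‖ ^ 2 := by
        rw [Finset.mul_sum]
        refine Finset.sum_congr rfl fun σ _ => ?_
        rw [← Finset.sum_filter, Finset.sum_const, nsmul_eq_mul]
        by_cases h0 : ψ σ = 0
        · simp [h0]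
        · rw [← hψ σ h0, downCard]

lemma norm_sq_exchange_le (ψ : Conf V → ℂ) (σ : Conf V) (e : Sym2 V) :
    ‖ψ σ - ψ (σ ∘ edgeSwap e)‖ ^ 2 ≤
      ∑ n, (if σ n = true then
        ‖addDown ψ (Function.update σ n false) n
          - addDown ψ (Function.update σ n false) (edgeSwap e n)‖ ^ 2 else 0) := by
  have hself (n : V) (hn : σ n = true) : addDown ψ (Function.update σ n false) n = ψ σ := by
    rw [addDown, if_neg (by simp), Function.update_idem, ← hn, Function.update_eq_self]
  have hterm (n : V) (hn : σ n = true) (hn' : σ (edgeSwap e n) = false)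
      (hsw : Equiv.swap n (edgeSwap e n) = edgeSwap e) :
      ‖ψ σ - ψ (σ ∘ edgeSwap e)‖ ^ 2 ≤
      ∑ n, (if σ n = true then
        ‖addDown ψ (Function.update σ n false) n
          - addDown ψ (Function.update σ n false) (edgeSwap e n)‖ ^ 2 else 0) := by
    refine le_trans (le_of_eq ?_) (Finset.single_le_sum
      (fun m _ => by split_ifs <;> positivity) (Finset.mem_univ n))
    rw [if_pos hn, hself n hn, addDown_update_swap ψ σ hn hn', hsw]
  have hfixed (h : σ ∘ edgeSwap e = σ) :
      ‖ψ σ - ψ (σ ∘ edgeSwap e)‖ ^ 2 ≤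
      ∑ n, (if σ n = true then
        ‖addDown ψ (Function.update σ n false) n
          - addDown ψ (Function.update σ n false) (edgeSwap e n)‖ ^ 2 else 0) := by
    rw [h, sub_self, norm_zero, zero_pow two_ne_zero]
    exact Finset.sum_nonneg fun m _ => by split_ifs <;> positivity
  induction e with
  | _ u v =>
    have hs : edgeSwap s(u, v) = Equiv.swap u v := rfl
    by_cases heq : σ u = σ v
    · refine hfixed ?_
      funext w
      rw [hs, Function.comp_apply, Equiv.swap_apply_def]
      split_ifs with h1 h2 <;> simp [*]
    · cases hu : σ u
      · have hv : σ v = true := by simpa [hu] using Ne.symm heq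
        exact hterm v hv (by simp [hs, hu]) (by simp [hs, Equiv.swap_comm])
      · have hv : σ v = false := by simpa [hu] using Ne.symm heq
        exact hterm u hu (by simp [hs, hv]) (by simp [hs])

lemma permForm_le_sum_addDown (ψ : Conf V → ℂ) (e : Sym2 V) :
    permForm (· ∘ edgeSwap e) ψ ≤ ∑ τ, permForm (edgeSwap e) (addDown ψ τ) := by
  refine (Finset.sum_le_sum fun σ _ => norm_sq_exchange_le ψ σ e).trans ?_
  rw [sum_removeDown fun τ n => ‖addDown ψ τ n - addDown ψ τ (edgeSwap e n)‖ ^ 2]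
  refine Finset.sum_le_sum fun τ _ => Finset.sum_le_sum fun n _ => ?_
  split_ifs
  · positivity
  · exact le_rfl

end Sites

/-- A lower bound on the eigenvalues of a Hermitian matrix bounds its quadratic form. -/
lemma Matrix.IsHermitian.le_star_dotProduct_mulVec {n : Type*} [Fintype n] [DecidableEq n]
    {A : Matrix n n ℂ} (hA : A.IsHermitian) {c : ℝ}
    (hc : ∀ E : ℝ, (∃ x : n → ℂ, x ≠ 0 ∧ A *ᵥ x = (E : ℂ) • x) → c ≤ E) (x : n → ℂ) :
    (c : ℂ) * (star x ⬝ᵥ x) ≤ star x ⬝ᵥ (A *ᵥ x) := by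
  have hB : (A - (c : ℂ) • (1 : Matrix n n ℂ)).IsHermitian := by
    refine hA.sub ?_
    simp [Matrix.IsHermitian, Matrix.conjTranspose_smul]
  have hpos : (A - (c : ℂ) • (1 : Matrix n n ℂ)).PosSemidef := by
    refine hB.posSemidef_iff_eigenvalues_nonneg.mpr fun i => ?_
    have hev := hB.mulVec_eigenvectorBasis i
    have hne : (⇑(hB.eigenvectorBasis i) : n → ℂ) ≠ 0 := fun h =>
      hB.eigenvectorBasis.orthonormal.ne_zero i (by ext k; exact congrFun h k)
    have := hc (hB.eigenvalues i + c) ⟨_, hne, by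
      rw [Matrix.sub_mulVec, Matrix.smul_mulVec, Matrix.one_mulVec, sub_eq_iff_eq_add] at hev
      rw [hev]
      push_cast
      rw [add_smul]
      rfl⟩
    simpa using this
  have := hpos.dotProduct_mulVec_nonneg x
  rw [Matrix.sub_mulVec, Matrix.smul_mulVec, Matrix.one_mulVec, dotProduct_sub,
    dotProduct_smul, smul_eq_mul] at this
  exact sub_nonneg.mp this

/-- (Proposition 3, bounding line) If `E₁` is the smallest eigenvalue of `H` on the one-magnon
sector and `E_a` the smallest eigenvalue of `H` on the `a`-magnon sector, then
`E_a ≥ (1−a)·N·j/8 + a·E₁`; equivalently every nonzero `ψ ∈ ℋ_a` satisfies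
`⟨ψ, H ψ⟩ ≥ ((1−a)·N·j/8 + a·E₁)·‖ψ‖²`. -/
theorem prop3_bounding_line [Fintype V] [DecidableEq V]
    (G : SimpleGraph V) [DecidableRel G.Adj] (N j : ℕ)
    (hN : Fintype.card V = N) (hreg : G.IsRegularOfDegree j)
    (a : ℕ) (ha : 1 ≤ a) (haN : a ≤ N) (E1 Ea : ℝ)
    (hE1 : IsLeast {E : ℝ | ∃ x : V → ℂ, x ≠ 0 ∧ H1 G *ᵥ x = (E : ℂ) • x} E1)
    (hEa : IsLeast {E : ℝ | ∃ ψ : Conf V → ℂ, ψ ≠ 0 ∧ (∀ σ, ψ σ ≠ 0 → downCard σ = a)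
        ∧ Ham G *ᵥ ψ = (E : ℂ) • ψ} Ea) :
    Ea ≥ (1 - (a : ℝ)) * N * j / 8 + a * E1
    ∧ ∀ ψ : Conf V → ℂ, ψ ≠ 0 → (∀ σ, ψ σ ≠ 0 → downCard σ = a) →
        (((1 - (a : ℝ)) * N * j / 8 + a * E1 : ℝ) : ℂ) * (star ψ ⬝ᵥ ψ)
          ≤ star ψ ⬝ᵥ (Ham G *ᵥ ψ) := by
  have hcard : (G.edgeFinset.card : ℝ) / 4 = N * j / 8 := by
    have h := G.sum_degrees_eq_twice_card_edges
    simp only [hreg.degree_eq, Finset.sum_const, Finset.card_univ, hN, smul_eq_mul] at h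
    have h' : (N * j : ℝ) = 2 * G.edgeFinset.card := by exact_mod_cast h
    linarith
  have hone (x : V → ℂ) : E1 * ∑ n, ‖x n‖ ^ 2 ≤
      G.edgeFinset.card / 4 * ∑ n, ‖x n‖ ^ 2
        - 1 / 4 * ∑ e ∈ G.edgeFinset, permForm (edgeSwap e) x := by
    have h := (H1_isHermitian G).le_star_dotProduct_mulVec (fun E hE => hE1.2 hE) x
    rw [star_dotProduct_H1, star_dotProduct_self_eq_sum_norm_sq] at h
    exact_mod_cast h
  have hbound (ψ : Conf V → ℂ) (hψ : ∀ σ, ψ σ ≠ 0 → downCard σ = a) :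
      (((1 - (a : ℝ)) * N * j / 8 + a * E1 : ℝ) : ℂ) * (star ψ ⬝ᵥ ψ)
        ≤ star ψ ⬝ᵥ (Ham G *ᵥ ψ) := by
    rw [star_dotProduct_Ham, star_dotProduct_self_eq_sum_norm_sq, ← Complex.ofReal_mul,
      Complex.real_le_real]
    have hsum := Finset.sum_le_sum fun τ (_ : τ ∈ Finset.univ) => hone (addDown ψ τ)
    rw [← Finset.mul_sum, Finset.sum_sub_distrib, ← Finset.mul_sum, ← Finset.mul_sum,
      Finset.sum_comm (s := Finset.univ) (t := G.edgeFinset),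
      sum_norm_sq_addDown ψ a hψ] at hsum
    have hform : ∑ e ∈ G.edgeFinset, permForm (· ∘ edgeSwap e) ψ ≤
        ∑ e ∈ G.edgeFinset, ∑ τ, permForm (edgeSwap e) (addDown ψ τ) :=
      Finset.sum_le_sum fun e _ => permForm_le_sum_addDown ψ e
    rw [hcard] at hsum ⊢
    linarith
  refine ⟨?_, fun ψ _ hψ => hbound ψ hψ⟩
  obtain ⟨ψ, hψ0, hψ, hev⟩ := hEa.1
  have h := hbound ψ hψ
  rw [hev, dotProduct_smul, smul_eq_mul] at h
  have hpos : 0 < star ψ ⬝ᵥ ψ := dotProduct_star_self_pos_iff.mpr hψ0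
  exact Complex.real_le_real.mp (le_of_mul_le_mul_right h hpos)
end
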